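/- Consider the unit-disk SNL case (U, r, n, a) with exponents b, c > 0, and assume there exist ε ∈ (0,1) and p_r ∈ (0,1] such that for every x ∈ U the probability that an independent uniform random point s′ of U satisfies εr ≤ ‖x − s′‖ ≤ r is at least p_r. Assume additionally that r > sup_{x,y∈U} ‖x − y‖, so that the graph of the random framework is surely complete (every sensor–sensor pair and every anchor–sensor pair is an edge). Then still, for every p₀ < 1 there exists N ∈ ℕ such that for all numbers of sensors n > N, the probability that the random loss function loss : (ℝ^d)^n → ℝ is not convex exceeds p₀. That is, even when all edges are given, the loss function is non-convex with high probability when the anchors are relatively few. -/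

import Mathlib

open MeasureTheory
open scoped Classical

/-- The uniform probability measure on a region `U` of Euclidean space. -/
noncomputable def unifMeasure {d : ℕ} (U : Set (EuclideanSpace ℝ (Fin d))) :
    Measure (EuclideanSpace ℝ (Fin d)) :=
  (volume U)⁻¹ • volume.restrict U

/-- The random loss function of the unit-disk SNL case: given sensor positions `S`,
the edges are the pairs at distance at most `r`, with distances given by the framework. -/
noncomputable def udLoss {d m : ℕ} (a : Fin m → EuclideanSpace ℝ (Fin d)) (r b c : ℝ)
    {n : ℕ} (S : Fin n → EuclideanSpace ℝ (Fin d))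
    (x : Fin n → EuclideanSpace ℝ (Fin d)) : ℝ :=
  ∑ p ∈ Finset.univ.filter
      (fun p : Fin n × Fin n => p.1 < p.2 ∧ dist (S p.1) (S p.2) ≤ r),
      |‖x p.1 - x p.2‖ ^ b - dist (S p.1) (S p.2) ^ b| ^ c
    + ∑ p ∈ Finset.univ.filter
      (fun p : Fin m × Fin n => dist (a p.1) (S p.2) ≤ r),
      |‖a p.1 - x p.2‖ ^ b - dist (a p.1) (S p.2) ^ b| ^ c

/-- A symmetric function vanishing on the diagonal sums over all pairs to twice its sum over the
increasing pairs. -/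
lemma two_mul_sum_filter_lt_eq {n : ℕ} (f : Fin n × Fin n → ℝ) (hsymm : ∀ p, f p.swap = f p)
    (hdiag : ∀ i, f (i, i) = 0) :
    2 * ∑ p ∈ Finset.univ.filter (fun p : Fin n × Fin n => p.1 < p.2), f p = ∑ p, f p := by
  have hswap : ∑ p : Fin n × Fin n, (if p.2 < p.1 then f p else 0)
      = ∑ p : Fin n × Fin n, if p.1 < p.2 then f p else 0 := by
    rw [← Equiv.sum_comp (Equiv.prodComm (Fin n) (Fin n))]
    exact Finset.sum_congr rfl fun p _ => by simp [hsymm]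
  rw [Finset.sum_filter, two_mul]
  nth_rewrite 2 [← hswap]
  rw [← Finset.sum_add_distrib]
  refine Finset.sum_congr rfl fun p _ => ?_
  obtain ⟨i, j⟩ := p
  rcases lt_trichotomy i j with h | h | h
  · simp [h, h.not_gt]
  · subst h; simp [hdiag]
  · simp [h, h.not_gt]

lemma abs_rpow_sub_rpow_le {x y R b : ℝ} (hx : 0 ≤ x) (hxR : x ≤ R) (hy : 0 ≤ y) (hyR : y ≤ R)
    (hb : 0 ≤ b) : |x ^ b - y ^ b| ≤ R ^ b := by
  have h1 := Real.rpow_le_rpow hx hxR hb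
  have h2 := Real.rpow_le_rpow hy hyR hb
  have h3 := Real.rpow_nonneg hx b
  have h4 := Real.rpow_nonneg hy b
  rw [abs_le]
  constructor <;> linarith

/-- If every sensor is far enough from the others on average, then the loss on a complete framework
is not convex: the point reflection of the framework is cheap, but the midpoint of the framework and
its reflection is a collapsed configuration, which is expensive. -/
lemma not_convexOn_udLoss {d m n : ℕ} (a : Fin m → EuclideanSpace ℝ (Fin d)) {r b c M : ℝ}
    (hb : 0 < b) (hc : 0 < c) (S : Fin n → EuclideanSpace ℝ (Fin d))
    (hn : 0 < n) (hS : ∀ i j, dist (S i) (S j) ≤ r) (haS : ∀ i j, dist (a i) (S j) ≤ r)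
    (hM : ∀ i, M ≤ ∑ j, (dist (S i) (S j) ^ b) ^ c) (hmM : m * ((2 * r) ^ b) ^ c < M) :
    ¬ ConvexOn ℝ Set.univ (udLoss a r b c S) := by
  intro hconv
  set q := S ⟨0, hn⟩
  have hr : 0 ≤ r := dist_nonneg.trans (hS ⟨0, hn⟩ ⟨0, hn⟩)
  have hn' : (0 : ℝ) < n := by exact_mod_cast hn
  have hself : udLoss a r b c S S = 0 := by
    simp [udLoss, ← dist_eq_norm, Real.zero_rpow hc.ne']
  have hrefl : udLoss a r b c S (fun i => q + q - S i) ≤ n * (m * ((2 * r) ^ b) ^ c) := by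
    have hpairs : ∀ i j, ‖(q + q - S i) - (q + q - S j)‖ = dist (S i) (S j) := by
      intro i j
      rw [dist_eq_norm, ← norm_neg (S i - S j)]
      congr 1; abel
    have hterm : ∀ p : Fin m × Fin n,
        |‖a p.1 - (q + q - S p.2)‖ ^ b - dist (a p.1) (S p.2) ^ b| ^ c ≤ ((2 * r) ^ b) ^ c := by
      intro p
      have h1 : ‖a p.1 - (q + q - S p.2)‖ ≤ 2 * r := by
        have h := norm_add_le (a p.1 - q) (S p.2 - q)
        rw [← dist_eq_norm, ← dist_eq_norm] at h
        have e : a p.1 - (q + q - S p.2) = a p.1 - q + (S p.2 - q) := by abel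
        rw [e]
        linarith [haS p.1 ⟨0, hn⟩, hS p.2 ⟨0, hn⟩]
      exact Real.rpow_le_rpow (abs_nonneg _) (abs_rpow_sub_rpow_le (norm_nonneg _) h1 dist_nonneg
        (by linarith [haS p.1 p.2]) hb.le) hc.le
    simp only [udLoss, hpairs, haS, sub_self, abs_zero, Real.zero_rpow hc.ne', Finset.sum_const_zero,
      zero_add, Finset.filter_true]
    refine (Finset.sum_le_card_nsmul _ _ _ fun p _ => hterm p).trans_eq ?_
    simp; ring
  have hmid : n * M ≤ 2 * udLoss a r b c S (fun _ => q) := by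
    have hdouble := two_mul_sum_filter_lt_eq
      (fun p : Fin n × Fin n => (dist (S p.1) (S p.2) ^ b) ^ c)
      (fun p => by simp [dist_comm])
      (fun i => by simp [Real.zero_rpow hb.ne', Real.zero_rpow hc.ne'])
    have hle : n * M ≤ ∑ p : Fin n × Fin n, (dist (S p.1) (S p.2) ^ b) ^ c := by
      rw [Fintype.sum_prod_type]
      simpa using Finset.card_nsmul_le_sum Finset.univ _ M fun i _ => hM i
    have hloss : ∑ p ∈ Finset.univ.filter (fun p : Fin n × Fin n => p.1 < p.2),
        (dist (S p.1) (S p.2) ^ b) ^ c ≤ udLoss a r b c S (fun _ => q) := by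
      simp only [udLoss, hS, and_true, sub_self, norm_zero, Real.zero_rpow hb.ne', zero_sub]
      refine le_add_of_le_of_nonneg (Finset.sum_le_sum fun p _ => ?_)
        (Finset.sum_nonneg fun p _ => Real.rpow_nonneg (abs_nonneg _) _)
      rw [abs_neg, abs_of_nonneg (Real.rpow_nonneg dist_nonneg _)]
    linarith
  have hconv' := hconv.2 (Set.mem_univ S) (Set.mem_univ fun i => q + q - S i)
    (by norm_num : (0 : ℝ) ≤ 1 / 2) (by norm_num : (0 : ℝ) ≤ 1 / 2) (by norm_num)
  have heq : (1 / 2 : ℝ) • S + (1 / 2 : ℝ) • (fun i => q + q - S i) = fun _ => q := by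
    funext i
    simp only [Pi.add_apply, Pi.smul_apply]
    module
  rw [heq, hself, smul_zero, zero_add, smul_eq_mul] at hconv'
  have := mul_lt_mul_of_pos_left hmM hn'
  linarith

/-- Points meeting two separated sets in each of `K` disjoint blocks of indices are far on average
from any point. -/
lemma le_sum_dist_rpow {E : Type*} [PseudoMetricSpace E] {n K : ℕ} {b c δ : ℝ} (hb : 0 < b)
    (hc : 0 < c) (hδ : 0 ≤ δ) (S : Fin n → E) (block : Fin n → ℕ) {A B : Set E}
    (hAB : ∀ x ∈ A, ∀ y ∈ B, δ ≤ dist x y)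
    (hA : ∀ k < K, ∃ i, block i = k ∧ S i ∈ A) (hB : ∀ k < K, ∃ i, block i = k ∧ S i ∈ B) (x : E) :
    K * ((δ / 2) ^ b) ^ c ≤ ∑ j, (dist x (S j) ^ b) ^ c := by
  have hnonneg : ∀ j, 0 ≤ (dist x (S j) ^ b) ^ c := fun j =>
    Real.rpow_nonneg (Real.rpow_nonneg dist_nonneg _) _
  have hmono : ∀ j, δ / 2 ≤ dist x (S j) → ((δ / 2) ^ b) ^ c ≤ (dist x (S j) ^ b) ^ c :=
    fun j h => Real.rpow_le_rpow (by positivity) (Real.rpow_le_rpow (by positivity) h hb.le) hc.le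
  have hblock : ∀ k ∈ Finset.range K,
      ((δ / 2) ^ b) ^ c ≤ ∑ j ∈ Finset.univ.filter (fun j => block j = k),
        (dist x (S j) ^ b) ^ c := by
    intro k hk
    obtain ⟨i, hik, hi⟩ := hA k (Finset.mem_range.1 hk)
    obtain ⟨j, hjk, hj⟩ := hB k (Finset.mem_range.1 hk)
    have htri := dist_triangle_left (S i) (S j) x
    have hfar := hAB _ hi _ hj
    rcases le_or_gt (δ / 2) (dist x (S i)) with h | h
    · exact (hmono i h).trans (Finset.single_le_sum
        (f := fun j => (dist x (S j) ^ b) ^ c) (fun j _ => hnonneg j) (by simp [hik]))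
    · exact (hmono j (by linarith)).trans (Finset.single_le_sum
        (f := fun j => (dist x (S j) ^ b) ^ c) (fun j _ => hnonneg j) (by simp [hjk]))
  calc K * ((δ / 2) ^ b) ^ c
      ≤ ∑ k ∈ Finset.range K, ∑ j ∈ Finset.univ.filter (fun j => block j = k),
        (dist x (S j) ^ b) ^ c := by
        simpa using Finset.card_nsmul_le_sum _ _ _ hblock
    _ = ∑ j ∈ Finset.univ.filter (fun j => block j ∈ Finset.range K),
        (dist x (S j) ^ b) ^ c := by
        rw [← Finset.sum_fiberwise_of_maps_to (s := Finset.univ.filter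
          (fun j => block j ∈ Finset.range K)) (t := Finset.range K) (g := block)
          (fun j hj => (Finset.mem_filter.1 hj).2)]
        refine Finset.sum_congr rfl fun k hk => Finset.sum_congr ?_ fun _ _ => rfl
        ext j
        simp only [Finset.mem_filter, Finset.mem_univ, true_and]
        exact ⟨fun h => ⟨h ▸ hk, h⟩, fun h => h.2⟩
    _ ≤ ∑ j, (dist x (S j) ^ b) ^ c :=
        Finset.sum_le_univ_sum_of_nonneg hnonneg

/-- The probability that a block of at least `L` independent points avoids a set. -/
lemma pi_forall_notMem_le {E : Type*} [MeasurableSpace E] (μ : Measure E) [IsProbabilityMeasure μ]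
    {n L : ℕ} (A : Set E) (s : Finset (Fin n)) (hs : L ≤ s.card) :
    Measure.pi (fun _ : Fin n => μ) {S | ∀ i ∈ s, S i ∉ A} ≤ μ Aᶜ ^ L := by
  have hset : {S : Fin n → E | ∀ i ∈ s, S i ∉ A}
      = Set.univ.pi fun i => if i ∈ s then Aᶜ else Set.univ := by
    ext S
    simp only [Set.mem_ofPred_eq, Set.mem_univ_pi]
    refine forall_congr' fun i => ?_
    split_ifs with h <;> simp [h]
  rw [hset, Measure.pi_pi]
  calc ∏ i, μ (if i ∈ s then Aᶜ else Set.univ) = ∏ i, if i ∈ s then μ Aᶜ else 1 :=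
        Finset.prod_congr rfl fun i _ => by split_ifs <;> simp
    _ = μ Aᶜ ^ s.card := by simp
    _ ≤ μ Aᶜ ^ L := pow_le_pow_right_of_le_one' prob_le_one hs

lemma le_card_filter_div_eq {n K L k : ℕ} (hL : 0 < L) (hn : K * L ≤ n) (hk : k < K) :
    L ≤ (Finset.univ.filter fun i : Fin n => (i : ℕ) / L = k).card := by
  have hlt : ∀ t : Fin L, k * L + t < n := fun t => by
    have : (k + 1) * L ≤ K * L := Nat.mul_le_mul_right L hk
    have := t.2
    nlinarith
  have hsub : Finset.univ.image (fun t : Fin L => (⟨k * L + t, hlt t⟩ : Fin n))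
      ⊆ Finset.univ.filter fun i : Fin n => (i : ℕ) / L = k := by
    intro i hi
    obtain ⟨t, -, rfl⟩ := Finset.mem_image.1 hi
    simp [Nat.mul_comm k L, Nat.mul_add_div hL, Nat.div_eq_of_lt t.2]
  refine le_trans ?_ (Finset.card_le_card hsub)
  rw [Finset.card_image_of_injective _ fun t u h => by
    simp only [Fin.mk.injEq] at h
    exact Fin.ext (by omega)]
  simp

/-- The probability that some of the first `K` blocks of length `L` avoids a set. -/
lemma pi_exists_block_notMem_le {E : Type*} [MeasurableSpace E] (μ : Measure E)
    [IsProbabilityMeasure μ] {n K L : ℕ} (hL : 0 < L) (hn : K * L ≤ n) (A : Set E) :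
    Measure.pi (fun _ : Fin n => μ) {S | ∃ k < K, ∀ i : Fin n, (i : ℕ) / L = k → S i ∉ A}
      ≤ K * μ Aᶜ ^ L := by
  have hset : {S : Fin n → E | ∃ k < K, ∀ i : Fin n, (i : ℕ) / L = k → S i ∉ A}
      = ⋃ k ∈ Finset.range K,
        {S | ∀ i ∈ Finset.univ.filter (fun i : Fin n => (i : ℕ) / L = k), S i ∉ A} := by
    ext S; simp
  rw [hset]
  refine (measure_biUnion_finset_le _ _).trans ?_
  refine (Finset.sum_le_card_nsmul _ _ _ fun k hk => pi_forall_notMem_le μ A _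
    (le_card_filter_div_eq hL hn (Finset.mem_range.1 hk))).trans_eq ?_
  simp

lemma isProbabilityMeasure_unifMeasure {d : ℕ} {U : Set (EuclideanSpace ℝ (Fin d))}
    (hUne : U.Nonempty) (hUb : Bornology.IsBounded U) (hUopen : IsOpen U) :
    IsProbabilityMeasure (unifMeasure U) :=
  ⟨by
    simp only [unifMeasure, Measure.smul_apply, Measure.restrict_apply_univ, smul_eq_mul]
    exact ENNReal.inv_mul_cancel (hUopen.measure_pos volume hUne).ne' hUb.measure_lt_top.ne⟩

lemma ae_mem_unifMeasure {d : ℕ} {U : Set (EuclideanSpace ℝ (Fin d))} (hUopen : IsOpen U) :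
    ∀ᵐ x ∂unifMeasure U, x ∈ U :=
  Measure.ae_smul_measure (ae_restrict_mem hUopen.measurableSet) _

lemma unifMeasure_compl_ball_lt_one {d : ℕ} {U : Set (EuclideanSpace ℝ (Fin d))}
    (hUne : U.Nonempty) (hUb : Bornology.IsBounded U) (hUopen : IsOpen U)
    {x : EuclideanSpace ℝ (Fin d)} (hx : x ∈ U) {δ : ℝ} (hδ : 0 < δ) :
    unifMeasure U (Metric.ball x δ)ᶜ < 1 := by
  have := isProbabilityMeasure_unifMeasure hUne hUb hUopen
  have hpos : 0 < unifMeasure U (Metric.ball x δ) := by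
    simp only [unifMeasure, Measure.smul_apply, smul_eq_mul,
      Measure.restrict_apply Metric.isOpen_ball.measurableSet]
    refine ENNReal.mul_pos (ENNReal.inv_ne_zero.2 hUb.measure_lt_top.ne) ?_
    exact ((Metric.isOpen_ball.inter hUopen).measure_pos volume
      ⟨x, Metric.mem_ball_self hδ, hx⟩).ne'
  rw [prob_compl_eq_one_sub Metric.isOpen_ball.measurableSet]
  exact ENNReal.sub_lt_self ENNReal.one_ne_top one_ne_zero hpos.ne'

/-- Even if the radius exceeds the diameter of the region, so that the random framework
is surely a complete graph, the loss function is still non-convex with high probability. -/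
theorem stmt2 {d m : ℕ} (U : Set (EuclideanSpace ℝ (Fin d)))
    (hUne : U.Nonempty) (hUb : Bornology.IsBounded U) (hUconn : IsConnected U)
    (hUopen : IsOpen U)
    (a : Fin m → EuclideanSpace ℝ (Fin d)) (ha : ∀ i, a i ∈ U)
    (r b c : ℝ) (hr : 0 < r) (hb : 0 < b) (hc : 0 < c)
    (ε pr : ℝ) (hε : ε ∈ Set.Ioo (0 : ℝ) 1) (hpr : pr ∈ Set.Ioc (0 : ℝ) 1)
    (hmin : ∀ x ∈ U, ENNReal.ofReal pr ≤
      unifMeasure U {s' | ε * r ≤ dist x s' ∧ dist x s' ≤ r})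
    (hcomplete : Metric.diam U < r) :
    ∀ p₀ : ℝ, p₀ < 1 → ∃ N : ℕ, ∀ n : ℕ, n > N →
      ENNReal.ofReal p₀ <
        Measure.pi (fun _ : Fin n => unifMeasure U)
          {S | ¬ ConvexOn ℝ Set.univ (udLoss a r b c S)} := by
  intro p₀ hp₀
  have hprob := isProbabilityMeasure_unifMeasure hUne hUb hUopen
  obtain ⟨x, hx⟩ := hUne
  obtain ⟨y, hy, hxy⟩ : ∃ y ∈ U, 0 < dist x y := by
    by_contra! hcon
    have hzero : unifMeasure U {s' | ε * r ≤ dist x s' ∧ dist x s' ≤ r} = 0 := by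
      refine measure_eq_zero_iff_ae_notMem.2 ?_
      filter_upwards [ae_mem_unifMeasure hUopen] with s hs h
      linarith [hcon s hs, h.1, mul_pos hε.1 hr]
    have := hmin x hx
    rw [hzero, nonpos_iff_eq_zero, ENNReal.ofReal_eq_zero] at this
    linarith [hpr.1]
  set δ := dist x y / 3 with hδ
  have hδpos : 0 < δ := by positivity
  have hsep : ∀ u ∈ Metric.ball x δ, ∀ v ∈ Metric.ball y δ, δ ≤ dist u v := by
    intro u hu v hv
    have h1 := dist_triangle4 x u v y
    rw [Metric.mem_ball, dist_comm] at hu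
    rw [Metric.mem_ball] at hv
    linarith
  obtain ⟨K, hK⟩ := exists_nat_gt (m * ((2 * r) ^ b) ^ c / ((δ / 2) ^ b) ^ c)
  rw [div_lt_iff₀ (by positivity)] at hK
  set A := Metric.ball x δ
  set B := Metric.ball y δ
  have htend : Filter.Tendsto
      (fun L : ℕ => K * unifMeasure U Aᶜ ^ L + K * unifMeasure U Bᶜ ^ L) Filter.atTop (nhds 0) := by
    have h : ∀ z ∈ U, Filter.Tendsto
        (fun L : ℕ => K * unifMeasure U (Metric.ball z δ)ᶜ ^ L) Filter.atTop (nhds 0) := by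
      intro z hz
      simpa using ENNReal.Tendsto.const_mul (ENNReal.tendsto_pow_atTop_nhds_zero_of_lt_one
        (unifMeasure_compl_ball_lt_one ⟨x, hx⟩ hUb hUopen hz hδpos))
        (Or.inr (ENNReal.natCast_ne_top K))
    simpa using (h x hx).add (h y hy)
  have hgap : ENNReal.ofReal p₀ < 1 := ENNReal.ofReal_lt_one.2 hp₀
  obtain ⟨L, hLsmall, hL⟩ := ((htend.eventually_lt_const (tsub_pos_of_lt hgap)).and
    (Filter.eventually_gt_atTop 0)).exists
  refine ⟨K * L, fun n hn => ?_⟩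
  set P := Measure.pi (fun _ : Fin n => unifMeasure U)
  have hmem : ∀ᵐ S ∂P, ∀ i, S i ∈ U := by
    rw [Filter.eventually_all]
    exact fun i => (Measure.tendsto_eval_ae_ae (i := i)).eventually (ae_mem_unifMeasure hUopen)
  set avoid : Set (EuclideanSpace ℝ (Fin d)) → Set (Fin n → EuclideanSpace ℝ (Fin d)) :=
    fun T => {S | ∃ k < K, ∀ i : Fin n, (i : ℕ) / L = k → S i ∉ T} with havoid
  have hcover : ∀ᵐ S ∂P, S ∈ {S | ¬ ConvexOn ℝ Set.univ (udLoss a r b c S)} ∪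
      (avoid A ∪ avoid B) := by
    filter_upwards [hmem] with S hS
    by_contra hcon
    simp only [havoid, Set.mem_union, not_or, Set.mem_ofPred_eq, not_exists, not_and, not_forall,
      not_not, exists_prop] at hcon
    obtain ⟨hconv, hA, hB⟩ := hcon
    have hdist : ∀ u ∈ U, ∀ v ∈ U, dist u v ≤ r := fun u hu v hv =>
      (Metric.dist_le_diam_of_mem hUb hu hv).trans hcomplete.le
    exact not_convexOn_udLoss a hb hc S (by omega) (fun i j => hdist _ (hS i) _ (hS j))
      (fun i j => hdist _ (ha i) _ (hS j))
      (fun i => le_sum_dist_rpow hb hc hδpos.le S (fun i => (i : ℕ) / L) hsep hA hB (S i))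
      hK hconv
  have hle : 1 ≤ P {S | ¬ ConvexOn ℝ Set.univ (udLoss a r b c S)} +
      (K * unifMeasure U Aᶜ ^ L + K * unifMeasure U Bᶜ ^ L) := by
    calc (1 : ENNReal) = P Set.univ := measure_univ.symm
      _ ≤ P ({S | ¬ ConvexOn ℝ Set.univ (udLoss a r b c S)} ∪ (avoid A ∪ avoid B)) :=
          measure_mono_ae (hcover.mono fun S hS _ => hS)
      _ ≤ _ := (measure_union_le _ _).trans (add_le_add_right ((measure_union_le _ _).trans
          (add_le_add (pi_exists_block_notMem_le _ hL hn.le A)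
            (pi_exists_block_notMem_le _ hL hn.le B))) _)
  by_contra! hcon
  have hlt := ENNReal.add_lt_add_of_le_of_lt (hcon.trans_lt (hgap.trans ENNReal.one_lt_top)).ne
    hcon hLsmall
  rw [add_tsub_cancel_of_le hgap.le] at hlt
  exact absurd hle hlt.not_ge
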